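/- arXiv:1903.02669 — 3 statements merged into one kernel-verified Lean document; each statement's English description precedes it below -/
import Mathlib

section
/- Fix a prime number p and let ℤ[1/p]/ℤ denote the quotient ℤ-module (Localization of ℤ away from p) / (image of ℤ). Then Hom_ℤ(ℤ[1/p]/ℤ, ℤ) = 0 and there is an isomorphism of abelian groups Ext¹_ℤ(ℤ[1/p]/ℤ, ℤ) ≅ ℤ_p. (This computes the derived p-adic completion of ℤ: Λ_p ℤ ≃ ℤ_p.) -/
open CategoryTheory

/-- The Prüfer `p`-group `ℤ[1/p]/ℤ`: the quotient of the localization of `ℤ` away from `p`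
by the image of the canonical map from `ℤ`. -/
abbrev PruferQuot (p : ℕ) : Type :=
  Localization.Away (p : ℤ) ⧸
    (Int.castRingHom (Localization.Away (p : ℤ))).toAddMonoidHom.range

namespace CategoryTheory.ShortComplex.ShortExact

open Limits ZeroObject

variable {C : Type*} [Category* C] [Abelian C] {S : ShortComplex C}

/-- The chain complex `⋯ ⟶ 0 ⟶ S.X₁ ⟶ S.X₂` attached to a short complex `S`. -/
noncomputable def chainComplexOf (S : ShortComplex C) : ChainComplex C ℕ :=
  ChainComplex.of
    (fun
      | 0 => S.X₂
      | 1 => S.X₁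
      | _ + 2 => 0)
    (fun
      | 0 => S.f
      | _ + 1 => 0)
    (fun _ => zero_comp)

lemma isZero_chainComplexOf_X (S : ShortComplex C) (n : ℕ) :
    IsZero ((chainComplexOf S).X (n + 2)) :=
  isZero_zero C

lemma chainComplexOf_d_one_zero (S : ShortComplex C) : (chainComplexOf S).d 1 0 = S.f := by
  simp [chainComplexOf, ChainComplex.of.d]

lemma chainComplexOf_d_one_zero_comp_g (S : ShortComplex C) :
    (chainComplexOf S).d 1 0 ≫ S.g = 0 := by
  rw [chainComplexOf_d_one_zero]
  exact S.zero

lemma chainComplexOf_exactAt_succ (hS : S.ShortExact) (n : ℕ) :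
    (chainComplexOf S).ExactAt (n + 1) := by
  rw [HomologicalComplex.exactAt_iff' _ (n + 1 + 1) (n + 1) n (by simp) (by simp)]
  match n with
  | 0 =>
    have := hS.mono_f
    refine (ShortComplex.exact_iff_mono ((chainComplexOf S).sc' 2 1 0)
      ((isZero_chainComplexOf_X S 0).eq_of_src _ _)).2 ?_
    change Mono ((chainComplexOf S).d 1 0)
    rwa [chainComplexOf_d_one_zero]
  | n + 1 => exact ShortComplex.exact_of_isZero_X₂ _ (isZero_chainComplexOf_X S n)

/-- A short exact sequence whose first two terms are projective is a projective resolution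
of its third term. -/
noncomputable def projectiveResolution (hS : S.ShortExact) [Projective S.X₁] [Projective S.X₂] :
    ProjectiveResolution S.X₃ where
  complex := chainComplexOf S
  projective n := match n with
    | 0 => inferInstanceAs (Projective S.X₂)
    | 1 => inferInstanceAs (Projective S.X₁)
    | n + 2 => (isZero_chainComplexOf_X S n).projective
  π := (ChainComplex.toSingle₀Equiv _ _).symm ⟨S.g, chainComplexOf_d_one_zero_comp_g S⟩
  quasiIso := ⟨fun n => by
    cases n
    · rw [ChainComplex.quasiIsoAt₀_iff, ShortComplex.quasiIso_iff_of_zeros']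
      · refine (ShortComplex.exact_and_epi_g_iff_of_iso ?_).2 ⟨hS.exact, hS.epi_g⟩
        exact ShortComplex.isoMk (Iso.refl _) (Iso.refl _) (Iso.refl _)
          ((Category.id_comp _).trans
            ((chainComplexOf_d_one_zero S).symm.trans (Category.comp_id _).symm))
          ((Category.id_comp _).trans (by
            refine Eq.trans ?_ (Category.comp_id _).symm
            exact (ChainComplex.toSingle₀Equiv_symm_apply_f_zero (C := chainComplexOf S) S.g
              (chainComplexOf_d_one_zero_comp_g S)).symm))
      all_goals rfl
    · rw [quasiIsoAt_iff_exactAt']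
      · exact chainComplexOf_exactAt_succ hS _
      · apply ChainComplex.exactAt_succ_single_obj⟩

/-- If `0 ⟶ S.X₁ ⟶ S.X₂ ⟶ S.X₃ ⟶ 0` is exact with `S.X₁` and `S.X₂` projective, then
`Ext¹(S.X₃, Y)` is the cokernel of `Hom(S.X₂, Y) ⟶ Hom(S.X₁, Y)`. -/
noncomputable def extOneIso {R : Type*} [Ring R] [Linear R C] [EnoughProjectives C]
    (hS : S.ShortExact) [Projective S.X₁] [Projective S.X₂] (Y : C) {A : ModuleCat R}
    (θ : ModuleCat.of R (S.X₁ ⟶ Y) ⟶ A)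
    (w : ModuleCat.ofHom (Linear.leftComp R Y S.f) ≫ θ = 0)
    (hθ : (ShortComplex.mk _ θ w).Exact) [Epi θ] :
    ((Ext R C 1).obj (Opposite.op S.X₃)).obj Y ≅ A := by
  let T := hS.projectiveResolution.complex.linearYonedaObj R Y
  have hd : T.d 0 1 = ModuleCat.ofHom (Linear.leftComp R Y S.f) :=
    congr_arg (fun f => ModuleCat.ofHom (Linear.leftComp R Y f)) (chainComplexOf_d_one_zero S)
  have w' : T.d 0 1 ≫ θ = 0 := by rw [hd]; exact w
  have hθ' : (ShortComplex.mk (T.d 0 1) θ w').Exact := by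
    revert w'
    rw [hd]
    exact fun _ => hθ
  have : Epi (ShortComplex.mk (T.d 0 1) θ w').g := inferInstanceAs (Epi θ)
  have hg : T.d 1 2 = 0 := by
    ext x
    exact (isZero_chainComplexOf_X S 0).eq_of_src _ _
  exact hS.projectiveResolution.isoExt 1 Y ≪≫
    ShortComplex.homologyMapIso (T.isoSc' 0 1 2 (by simp) (by simp)) ≪≫
    (ShortComplex.LeftHomologyData.ofIsColimitCokernelCofork (T.sc' 0 1 2) hg
      (CokernelCofork.ofπ θ w') hθ'.gIsCokernel).homologyIso

end CategoryTheory.ShortComplex.ShortExact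

section

open Polynomial

/-- The endomorphism of `ℤ[X]` sending `X ^ (n + 1)` to `p X ^ (n + 1) - X ^ n` and `1` to `p`. -/
noncomputable def pruferRelation (p : ℕ) : ℤ[X] →ₗ[ℤ] ℤ[X] :=
  (p : ℤ) • LinearMap.id - (divX_hom (R := ℤ)).toIntLinearMap

lemma pruferRelation_apply (p : ℕ) (f : ℤ[X]) : pruferRelation p f = C (p : ℤ) * f - divX f := by
  simp [pruferRelation, divX_hom, zsmul_eq_mul]

lemma X_mul_pruferRelation (p : ℕ) (f : ℤ[X]) :
    X * pruferRelation p f = (C (p : ℤ) * X - 1) * f + C (f.coeff 0) := by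
  rw [pruferRelation_apply]
  linear_combination -divX_mul_X_add f

lemma pruferRelation_injective {p : ℕ} (hp : p ≠ 0) : Function.Injective (pruferRelation p) := by
  rw [injective_iff_map_eq_zero]
  intro f hf
  rw [pruferRelation_apply, sub_eq_zero] at hf
  have hc (n k : ℕ) : f.coeff (n + k) = p ^ n * f.coeff k := by
    induction n with
    | zero => simp
    | succ n ih =>
      have : f.coeff (n + k + 1) = p * f.coeff (n + k) := by
        simpa using (congr_arg (coeff · (n + k)) hf).symm
      rw [Nat.add_right_comm, this, ih]; ring
  ext k
  have := hc (f.natDegree + 1) k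
  rw [coeff_eq_zero_of_natDegree_lt (by lia)] at this
  simpa [hp] using this.symm

/-- Evaluation `ℤ[X] → ℤ[1/p]` at `1/p`. -/
noncomputable def evalInv (p : ℕ) : ℤ[X] →ₐ[ℤ] Localization.Away (p : ℤ) :=
  ((Localization.awayEquivAdjoin (p : ℤ)).symm : _ →ₐ[ℤ] _).comp
    ((AdjoinRoot.mkₐ (C (p : ℤ) * X - 1)).restrictScalars ℤ)

lemma evalInv_surjective (p : ℕ) : Function.Surjective (evalInv p) :=
  (Localization.awayEquivAdjoin (p : ℤ)).symm.surjective.comp AdjoinRoot.mk_surjective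

lemma evalInv_eq_zero_iff (p : ℕ) (f : ℤ[X]) : evalInv p f = 0 ↔ C (p : ℤ) * X - 1 ∣ f := by
  rw [← AdjoinRoot.mk_eq_zero]
  exact (Localization.awayEquivAdjoin (p : ℤ)).symm.map_eq_zero_iff

/-- The map `ℤ[X] → ℤ[1/p]/ℤ` sending `X ^ n` to the class of `1 / p ^ (n + 1)`. -/
noncomputable def pruferGenerators (p : ℕ) : ℤ[X] →ₗ[ℤ] PruferQuot p :=
  ((QuotientAddGroup.mk' (Int.castRingHom (Localization.Away (p : ℤ))).toAddMonoidHom.range).comp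
    ((evalInv p : ℤ[X] →+ Localization.Away (p : ℤ)).comp (AddMonoidHom.mulLeft X))).toIntLinearMap

lemma pruferGenerators_apply (p : ℕ) (f : ℤ[X]) :
    pruferGenerators p f = QuotientAddGroup.mk (evalInv p (X * f)) := rfl

lemma pruferGenerators_eq_zero_iff (p : ℕ) (f : ℤ[X]) :
    pruferGenerators p f = 0 ↔ ∃ c : ℤ, C (p : ℤ) * X - 1 ∣ X * f - C c := by
  rw [pruferGenerators_apply, QuotientAddGroup.eq_zero_iff]
  refine exists_congr fun c => ?_
  rw [← evalInv_eq_zero_iff, map_sub, sub_eq_zero, eq_comm]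
  have : evalInv p (C c) = c := (evalInv p).commutes c |>.trans (by simp)
  rw [this]
  rfl

lemma pruferGenerators_surjective (p : ℕ) : Function.Surjective (pruferGenerators p) := by
  intro y
  induction y using QuotientAddGroup.induction_on with
  | H y =>
    obtain ⟨h, rfl⟩ := evalInv_surjective p y
    refine ⟨divX h, ?_⟩
    rw [pruferGenerators_apply, QuotientAddGroup.eq]
    refine ⟨h.coeff 0, ?_⟩
    have : evalInv p (C (h.coeff 0)) = h.coeff 0 := (evalInv p).commutes _ |>.trans (by simp)
    calc (h.coeff 0 : Localization.Away (p : ℤ))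
        = evalInv p (h - X * divX h) := by
          rw [← this]; congr 1; linear_combination X_mul_divX_add h
      _ = _ := by rw [map_sub]; abel

lemma exact_pruferRelation_pruferGenerators (p : ℕ) :
    Function.Exact (pruferRelation p) (pruferGenerators p) := by
  intro f
  rw [pruferGenerators_eq_zero_iff]
  constructor
  · rintro ⟨c, g, hg⟩
    refine ⟨g, ?_⟩
    have h0 : c = g.coeff 0 := by
      simpa using congr_arg (coeff · 0) hg
    apply mul_left_cancel₀ (X_ne_zero (R := ℤ))
    rw [X_mul_pruferRelation, ← hg, h0, sub_add_cancel]
  · rintro ⟨g, rfl⟩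
    exact ⟨g.coeff 0, g, by rw [X_mul_pruferRelation, add_sub_cancel_right]⟩

end

section

variable (p : ℕ) [Fact p.Prime]

lemma PadicInt.summable_mul_pow (b : ℕ → ℤ_[p]) : Summable fun n => b n * (p : ℤ_[p]) ^ n := by
  have hp : 1 < (p : ℝ) := mod_cast (Fact.out : p.Prime).one_lt
  refine Summable.of_norm_bounded (g := fun n => ((p : ℝ)⁻¹) ^ n)
    (summable_geometric_of_lt_one (by positivity) (inv_lt_one_of_one_lt₀ hp)) fun n => ?_
  rw [norm_mul, norm_pow, PadicInt.norm_p]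
  exact mul_le_of_le_one_left (by positivity) (PadicInt.norm_le_one _)

/-- The map `ℤ^ℕ → ℤ_p` sending `b` to `∑ bₙ pⁿ`. -/
noncomputable def padicSeries : (ℕ → ℤ) →ₗ[ℤ] ℤ_[p] :=
  AddMonoidHom.toIntLinearMap
    { toFun b := ∑' n, (b n : ℤ_[p]) * (p : ℤ_[p]) ^ n
      map_zero' := by simp
      map_add' b c := by
        rw [← (PadicInt.summable_mul_pow p _).tsum_add (PadicInt.summable_mul_pow p _)]
        simp [add_mul] }

lemma padicSeries_apply (b : ℕ → ℤ) :
    padicSeries p b = ∑' n, (b n : ℤ_[p]) * (p : ℤ_[p]) ^ n := rfl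

variable {p} in
lemma PadicInt.eq_zero_of_forall_pow_dvd {x : ℤ_[p]} (h : ∀ n : ℕ, (p : ℤ_[p]) ^ n ∣ x) :
    x = 0 := by
  rw [← PadicInt.ext_of_toZModPow]
  intro n
  rw [map_zero, ← RingHom.mem_ker, PadicInt.ker_toZModPow, Ideal.mem_span_singleton]
  exact h n

lemma padicSeries_eq_sum_add (b : ℕ → ℤ) (n : ℕ) :
    padicSeries p b = ((∑ k ∈ Finset.range n, b k * (p : ℤ) ^ k : ℤ) : ℤ_[p]) +
      p ^ n * padicSeries p (fun k => b (k + n)) := by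
  rw [padicSeries_apply, padicSeries_apply,
    ← (PadicInt.summable_mul_pow p fun k => (b k : ℤ_[p])).sum_add_tsum_nat_add n,
    ← (PadicInt.summable_mul_pow p fun k => (b (k + n) : ℤ_[p])).tsum_mul_left]
  push_cast
  congr 2 with k
  ring

lemma padicSeries_surjective : Function.Surjective (padicSeries p) := by
  intro x
  choose b hb using fun n => x.dvd_appr_sub_appr n (n + 1) n.le_succ
  refine ⟨fun n => b n, (sub_eq_zero.1 <| PadicInt.eq_zero_of_forall_pow_dvd fun n => ?_).symm⟩
  have hsum : ∑ k ∈ Finset.range n, (b k : ℤ) * (p : ℤ) ^ k = x.appr n := by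
    induction n with
    | zero => simp [PadicInt.appr]
    | succ n ih =>
      have := x.appr_mono n.le_succ
      rw [Finset.sum_range_succ, ih, mul_comm]
      have hb := hb n
      zify [this] at hb
      linear_combination -hb
  rw [padicSeries_eq_sum_add p _ n, hsum, ← sub_sub, Int.cast_natCast]
  exact dvd_sub (Ideal.mem_span_singleton.1 (PadicInt.appr_spec n x)) (dvd_mul_right _ _)

lemma padicSeries_eq_zero_iff (b : ℕ → ℤ) :
    padicSeries p b = 0 ↔
      ∃ a : ℕ → ℤ, b 0 = p * a 0 ∧ ∀ n, b (n + 1) = p * a (n + 1) - a n := by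
  have hp : (p : ℤ) ≠ 0 := mod_cast (Fact.out : p.Prime).ne_zero
  constructor
  · intro h
    have hdvd (n : ℕ) : (p : ℤ) ^ n ∣ ∑ k ∈ Finset.range n, b k * (p : ℤ) ^ k := by
      rw [← PadicInt.pow_p_dvd_int_iff]
      refine ⟨-padicSeries p fun k => b (k + n), ?_⟩
      rw [padicSeries_eq_sum_add p b n] at h
      linear_combination h
    choose a ha using fun n => hdvd (n + 1)
    refine ⟨a, by simpa using ha 0, fun n => ?_⟩
    have := ha (n + 1)
    rw [Finset.sum_range_succ, ha n] at this
    apply mul_left_cancel₀ (pow_ne_zero (n + 1) hp)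
    linear_combination this
  · rintro ⟨a, h0, h⟩
    have hsum (n : ℕ) : ∑ k ∈ Finset.range (n + 1), b k * (p : ℤ) ^ k = p ^ (n + 1) * a n := by
      induction n with
      | zero => simp [h0]
      | succ n ih => rw [Finset.sum_range_succ, ih, h]; ring
    refine PadicInt.eq_zero_of_forall_pow_dvd fun n => (pow_dvd_pow _ n.le_succ).trans ?_
    rw [padicSeries_eq_sum_add p b (n + 1), hsum]
    push_cast
    exact dvd_add (dvd_mul_right _ _) (dvd_mul_right _ _)
end

section

open Polynomial

/-- Evaluation on the monomials `X ^ n`, as a map from the dual of `ℤ[X]` to sequences. -/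
noncomputable def coeffDual : (ℤ[X] →ₗ[ℤ] ℤ) ≃ₗ[ℤ] (ℕ → ℤ) :=
  ((basisMonomials ℤ).constr ℤ).symm

lemma coeffDual_apply (φ : ℤ[X] →ₗ[ℤ] ℤ) (n : ℕ) : coeffDual φ n = φ (X ^ n) := by
  simp [coeffDual, Module.Basis.constr, X_pow_eq_monomial]

lemma coeffDual_comp_pruferRelation_zero (p : ℕ) (φ : ℤ[X] →ₗ[ℤ] ℤ) :
    coeffDual (φ ∘ₗ pruferRelation p) 0 = p * coeffDual φ 0 := by
  have : pruferRelation p (X ^ 0) = (p : ℤ) • X ^ 0 := by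
    rw [pruferRelation_apply]
    simp
  rw [coeffDual_apply, coeffDual_apply, LinearMap.comp_apply, this, map_smul, smul_eq_mul]

lemma coeffDual_comp_pruferRelation_succ (p : ℕ) (φ : ℤ[X] →ₗ[ℤ] ℤ) (n : ℕ) :
    coeffDual (φ ∘ₗ pruferRelation p) (n + 1) = p * coeffDual φ (n + 1) - coeffDual φ n := by
  have : pruferRelation p (X ^ (n + 1)) = (p : ℤ) • X ^ (n + 1) - X ^ n := by
    rw [pruferRelation_apply, divX_X_pow]
    simp
  simp only [coeffDual_apply, LinearMap.comp_apply, this, map_sub, map_smul, smul_eq_mul]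

variable (p : ℕ) [Fact p.Prime]

/-- The map `Hom(ℤ[X], ℤ) → ℤ_p` sending `φ` to `∑ φ(Xⁿ) pⁿ`. -/
noncomputable def dualToPadicInt : (ℤ[X] →ₗ[ℤ] ℤ) →ₗ[ℤ] ℤ_[p] :=
  padicSeries p ∘ₗ coeffDual.toLinearMap

lemma dualToPadicInt_surjective : Function.Surjective (dualToPadicInt p) :=
  (padicSeries_surjective p).comp coeffDual.surjective

lemma dualToPadicInt_eq_zero_iff (ψ : ℤ[X] →ₗ[ℤ] ℤ) :
    dualToPadicInt p ψ = 0 ↔ ∃ φ : ℤ[X] →ₗ[ℤ] ℤ, φ ∘ₗ pruferRelation p = ψ := by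
  change padicSeries p (coeffDual ψ) = 0 ↔ _
  rw [padicSeries_eq_zero_iff, coeffDual.surjective.exists]
  refine exists_congr fun φ => ⟨fun ⟨h0, h⟩ => coeffDual.injective (funext fun n => ?_), ?_⟩
  · cases n with
    | zero => rw [coeffDual_comp_pruferRelation_zero, h0]
    | succ n => rw [coeffDual_comp_pruferRelation_succ, h]
  · rintro rfl
    exact ⟨coeffDual_comp_pruferRelation_zero p φ, coeffDual_comp_pruferRelation_succ p φ⟩

lemma eq_zero_of_comp_pruferRelation_eq_zero {φ : ℤ[X] →ₗ[ℤ] ℤ}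
    (h : φ ∘ₗ pruferRelation p = 0) :
    φ = 0 := by
  have hp : p ≠ 0 := (Fact.out : p.Prime).ne_zero
  refine coeffDual.injective (funext fun n => ?_)
  induction n with
  | zero =>
    have := coeffDual_comp_pruferRelation_zero p φ
    rw [h] at this
    simpa [hp] using this
  | succ n ih =>
    have := coeffDual_comp_pruferRelation_succ p φ n
    rw [h, ih] at this
    simpa [hp] using this

/-- The sequence `0 ⟶ ℤ[X] ⟶ ℤ[X] ⟶ ℤ[1/p]/ℤ ⟶ 0`. -/
noncomputable abbrev pruferShortComplex : ShortComplex (ModuleCat.{0} ℤ) :=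
  ShortComplex.mk (ModuleCat.ofHom (pruferRelation p)) (ModuleCat.ofHom (pruferGenerators p))
    (ModuleCat.hom_ext (exact_pruferRelation_pruferGenerators p).linearMap_comp_eq_zero)

lemma pruferShortComplex_shortExact : (pruferShortComplex p).ShortExact where
  exact := (ShortComplex.ShortExact.moduleCat_exact_iff_function_exact _).2
    (exact_pruferRelation_pruferGenerators p)
  mono_f := (ModuleCat.mono_iff_injective _).2
    (pruferRelation_injective (Fact.out : p.Prime).ne_zero)
  epi_g := (ModuleCat.epi_iff_surjective _).2 (pruferGenerators_surjective p)

instance : Projective (pruferShortComplex p).X₁ :=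
  ModuleCat.projective_of_free (basisMonomials ℤ)

instance : Projective (pruferShortComplex p).X₂ :=
  ModuleCat.projective_of_free (basisMonomials ℤ)

/-- `dualToPadicInt`, as a morphism out of a hom module of the category of `ℤ`-modules. -/
noncomputable def homToPadicInt :
    ModuleCat.of ℤ ((pruferShortComplex p).X₁ ⟶ ModuleCat.of ℤ ℤ) ⟶ ModuleCat.of ℤ ℤ_[p] :=
  ModuleCat.ofHom (dualToPadicInt p ∘ₗ (ModuleCat.homLinearEquiv (S := ℤ)).toLinearMap)

lemma leftComp_comp_homToPadicInt :
    ModuleCat.ofHom (Linear.leftComp ℤ (ModuleCat.of ℤ ℤ) (pruferShortComplex p).f) ≫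
      homToPadicInt p = 0 := by
  ext φ
  exact (dualToPadicInt_eq_zero_iff p _).2 ⟨ModuleCat.Hom.hom φ, rfl⟩

lemma exact_leftComp_homToPadicInt :
    (ShortComplex.mk _ _ (leftComp_comp_homToPadicInt p)).Exact := by
  refine (ShortComplex.ShortExact.moduleCat_exact_iff_function_exact _).2 fun ψ => ?_
  refine (dualToPadicInt_eq_zero_iff p (ModuleCat.Hom.hom ψ)).trans ⟨?_, ?_⟩
  · rintro ⟨φ, hφ⟩
    exact ⟨ModuleCat.ofHom φ, ModuleCat.hom_ext hφ⟩
  · rintro ⟨φ, rfl⟩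
    exact ⟨ModuleCat.Hom.hom φ, rfl⟩

instance : Epi (homToPadicInt p) :=
  (ModuleCat.epi_iff_surjective _).2 <|
    (dualToPadicInt_surjective p).comp (ModuleCat.homLinearEquiv (S := ℤ)).surjective

end

/-- `Hom_ℤ(ℤ[1/p]/ℤ, ℤ) = 0` and `Ext¹_ℤ(ℤ[1/p]/ℤ, ℤ) ≅ ℤ_p`: the derived `p`-adic
completion of `ℤ` is the ring of `p`-adic integers. -/
theorem derived_completion_of_int (p : ℕ) [Fact p.Prime] :
    (∀ f : PruferQuot p →ₗ[ℤ] ℤ, f = 0) ∧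
    Nonempty ((((Ext ℤ (ModuleCat ℤ) 1).obj
        (Opposite.op (ModuleCat.of ℤ (PruferQuot p)))).obj (ModuleCat.of ℤ ℤ)) ≃+ ℤ_[p]) := by
  refine ⟨fun f => ?_, ?_⟩
  · have h : f ∘ₗ pruferGenerators p = 0 := eq_zero_of_comp_pruferRelation_eq_zero p (by
      rw [LinearMap.comp_assoc,
        (exact_pruferRelation_pruferGenerators p).linearMap_comp_eq_zero, LinearMap.comp_zero])
    rwa [← LinearMap.cancel_right (pruferGenerators_surjective p), LinearMap.zero_comp]
  · exact ⟨((pruferShortComplex_shortExact p).extOneIso (ModuleCat.of ℤ ℤ)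
      (homToPadicInt p) (leftComp_comp_homToPadicInt p)
      (exact_leftComp_homToPadicInt p)).toLinearEquiv.toAddEquiv⟩
end

section
/- Let ℚ/ℤ denote the quotient ℤ-module ℚ / (image of ℤ). Then Hom_ℤ(ℚ/ℤ, ℤ) = 0 and there is an isomorphism of abelian groups Ext¹_ℤ(ℚ/ℤ, ℤ) ≅ ∏_p ℤ_p, the product over all prime numbers p of the rings of p-adic integers. (This computes the completion of ℤ at all closed points of its spectrum, the top-left corner of the Hasse square.) -/
open CategoryTheory

instance (p : Nat.Primes) : Fact (p : ℕ).Prime := ⟨p.2⟩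

/-- The product over all prime numbers `p` of the rings of `p`-adic integers. -/
abbrev Zhat : Type := Π p : Nat.Primes, ℤ_[(p : ℕ)]

/-- The `ℤ`-module `ℚ/ℤ`: the quotient of `ℚ` by the image of the canonical map from `ℤ`. -/
abbrev RatModInt : Type :=
  ℚ ⧸ (Int.castRingHom ℚ).toAddMonoidHom.range

open Limits Filter Topology
open scoped Nat

/-- The chain complex `⋯ ⟶ 0 ⟶ A ⟶ B` attached to a morphism `A ⟶ B`. -/
noncomputable def ChainComplex.twoTerm {R : Type} [CommRing R] {A B : ModuleCat.{0} R}
    (f : A ⟶ B) : ChainComplex (ModuleCat.{0} R) ℕ where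
  X | 0 => B
    | 1 => A
    | _ + 2 => ModuleCat.of R PUnit
  d | 1, 0 => f
    | 0, _ => 0
    | 1, _ + 1 => 0
    | _ + 2, _ => 0
  shape i j h := by
    match i, j with
    | 1, 0 => simp at h
    | 0, _ => rfl
    | 1, _ + 1 => rfl
    | _ + 2, _ => rfl
  d_comp_d' i j k hij hjk := by
    obtain rfl : j + 1 = i := hij
    obtain rfl : k + 1 = j := hjk
    exact zero_comp

/-- A short exact sequence `0 ⟶ X₁ ⟶ X₂ ⟶ X₃ ⟶ 0` with `X₁` and `X₂` projective is a projective
resolution of `X₃`. -/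
noncomputable def CategoryTheory.ShortComplex.ShortExact.projectiveResolution_s8
    {R : Type} [CommRing R] {S : ShortComplex (ModuleCat.{0} R)} (hS : S.ShortExact)
    [h₁ : Projective S.X₁] [h₂ : Projective S.X₂] : ProjectiveResolution S.X₃ where
  complex := ChainComplex.twoTerm S.f
  projective
    | 0 => h₂
    | 1 => h₁
    | _ + 2 => (ModuleCat.isZero_of_subsingleton (ModuleCat.of R PUnit)).projective
  π := (ChainComplex.toSingle₀Equiv _ _).symm ⟨S.g, S.zero⟩
  quasiIso := ⟨fun n => by
    match n with
    | 0 =>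
      rw [ChainComplex.quasiIsoAt₀_iff, ShortComplex.quasiIso_iff_of_zeros' _ rfl rfl rfl]
      exact ⟨hS.exact, hS.epi_g⟩
    | 1 =>
      rw [quasiIsoAt_iff_exactAt' (hL := ChainComplex.exactAt_succ_single_obj ..),
        HomologicalComplex.exactAt_iff' _ 2 1 0 (by simp) (by simp)]
      exact (ShortComplex.exact_iff_mono _ rfl).2 hS.mono_f
    | n + 2 =>
      rw [quasiIsoAt_iff_exactAt' (hL := ChainComplex.exactAt_succ_single_obj ..),
        HomologicalComplex.exactAt_iff' _ (n + 3) (n + 2) (n + 1) (by simp) (by simp)]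
      exact ShortComplex.exact_of_isZero_X₂ _
        (ModuleCat.isZero_of_subsingleton (ModuleCat.of R PUnit))⟩

/-- If `0 ⟶ X₁ ⟶ X₂ ⟶ X₃ ⟶ 0` is a short exact sequence with `X₁` and `X₂` projective, then
`Ext¹(X₃, Y)` is isomorphic to any cokernel of `Hom(X₂, Y) → Hom(X₁, Y)`. -/
theorem CategoryTheory.ShortComplex.ShortExact.nonempty_ext_one_iso
    {R : Type} [CommRing R] {S : ShortComplex (ModuleCat.{0} R)} (hS : S.ShortExact)
    [Projective S.X₁] [Projective S.X₂] {Y : ModuleCat.{0} R}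
    {A : Type} [AddCommGroup A] [Module R A] (Φ : (S.X₁ ⟶ Y) →ₗ[R] A)
    (hΦ : Function.Surjective Φ) (hker : ∀ f, Φ f = 0 ↔ ∃ g : S.X₂ ⟶ Y, S.f ≫ g = f) :
    Nonempty (((Ext R (ModuleCat.{0} R) 1).obj (Opposite.op S.X₃)).obj Y ≅ ModuleCat.of R A) := by
  let K := hS.projectiveResolution_s8.complex.linearYonedaObj R Y
  let T : ShortComplex (ModuleCat R) := ShortComplex.mk (K.d 0 1)
    (ModuleCat.ofHom Φ : ModuleCat.of R (S.X₁ ⟶ Y) ⟶ ModuleCat.of R A) (by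
      ext g
      exact (hker _).2 ⟨g, rfl⟩)
  have hT : T.Exact := by
    rw [ShortComplex.moduleCat_exact_iff]
    exact fun f hf => (hker f).1 hf
  have : Epi T.g := (ModuleCat.epi_iff_surjective _).2 hΦ
  have hg : (K.sc' 0 1 2).g = 0 := by
    ext f
    exact (zero_comp : (0 : ModuleCat.of R PUnit ⟶ S.X₁) ≫ (f : S.X₁ ⟶ Y) = 0)
  exact ⟨hS.projectiveResolution_s8.isoExt 1 Y ≪≫
    ShortComplex.homologyMapIso (K.isoSc' 0 1 2 (by simp) (by simp)) ≪≫
    (ShortComplex.LeftHomologyData.ofIsColimitCokernelCofork (K.sc' 0 1 2) hg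
      (CokernelCofork.ofπ T.g T.zero :) hT.gIsCokernel).homologyIso⟩

theorem PadicInt.norm_mul_le_left {p : ℕ} [Fact p.Prime] (x y : ℤ_[p]) : ‖x * y‖ ≤ ‖x‖ := by
  rw [norm_mul]
  exact mul_le_of_le_one_right (norm_nonneg _) y.norm_le_one

theorem PadicInt.tendsto_factorial_mul {p : ℕ} [hp : Fact p.Prime] (u : ℕ → ℤ_[p]) :
    Tendsto (fun n : ℕ => (n ! : ℤ_[p]) * u n) atTop (𝓝 0) := by
  rw [Metric.tendsto_atTop]
  intro ε hε
  obtain ⟨m, hm⟩ := PadicInt.exists_pow_neg_lt p hε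
  refine ⟨p ^ m, fun n hn => ?_⟩
  rw [dist_zero_right]
  refine ((PadicInt.norm_mul_le_left _ _).trans ?_).trans_lt hm
  have h : ((p ^ m : ℕ) : ℤ) ∣ (n ! : ℤ) :=
    Int.natCast_dvd_natCast.2 (Nat.dvd_factorial (pow_pos hp.out.pos m) hn)
  exact_mod_cast (PadicInt.norm_int_le_pow_iff_dvd (p := p)).2 h

theorem PadicInt.summable_factorial_mul {p : ℕ} [Fact p.Prime] (u : ℕ → ℤ_[p]) :
    Summable (fun k : ℕ => (k ! : ℤ_[p]) * u k) := by
  apply NonarchimedeanAddGroup.summable_of_tendsto_cofinite_zero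
  rw [Nat.cofinite_eq_atTop]
  exact PadicInt.tendsto_factorial_mul u

theorem PadicInt.norm_tsum_factorial_mul_sub_le {p : ℕ} [Fact p.Prime] (u : ℕ → ℤ_[p]) (n : ℕ) :
    ‖∑' k : ℕ, (k ! : ℤ_[p]) * u k - ∑ k ∈ Finset.range n, (k ! : ℤ_[p]) * u k‖
      ≤ ‖(n ! : ℤ_[p])‖ := by
  rw [← (PadicInt.summable_factorial_mul u).sum_add_tsum_nat_add n, add_sub_cancel_left]
  refine IsUltrametricDist.norm_tsum_le_of_forall_le_of_nonneg (norm_nonneg _) fun k => ?_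
  refine (PadicInt.norm_mul_le_left _ _).trans ?_
  obtain ⟨c, hc⟩ := Nat.factorial_dvd_factorial (Nat.le_add_left n k)
  rw [hc, Nat.cast_mul]
  exact PadicInt.norm_mul_le_left _ _

theorem PadicInt.tsum_factorial_mul_eq {p : ℕ} [Fact p.Prime] {u z : ℕ → ℤ_[p]} {x : ℤ_[p]}
    (h : ∀ n, x = ∑ k ∈ Finset.range n, (k ! : ℤ_[p]) * u k + (n ! : ℤ_[p]) * z n) :
    ∑' k : ℕ, (k ! : ℤ_[p]) * u k = x := by
  refine HasSum.tsum_eq ?_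
  rw [(PadicInt.summable_factorial_mul u).hasSum_iff_tendsto_nat]
  have := (PadicInt.tendsto_factorial_mul z).const_sub x
  rw [sub_zero] at this
  exact this.congr fun n => by linear_combination h n

theorem Int.natCast_dvd_of_forall_norm_le {m : ℕ} {s : ℤ}
    (h : ∀ p : Nat.Primes, ‖(s : ℤ_[(p : ℕ)])‖ ≤ ‖(m : ℤ_[(p : ℕ)])‖) : (m : ℤ) ∣ s := by
  rw [Int.natCast_dvd]
  refine (Nat.dvd_iff_prime_pow_dvd_dvd _ _).2 fun p k hp hk => ?_
  have := Fact.mk hp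
  rw [← Int.natCast_dvd, Nat.cast_pow, ← PadicInt.norm_int_le_pow_iff_dvd]
  refine (h ⟨p, hp⟩).trans ?_
  exact_mod_cast (PadicInt.norm_int_le_pow_iff_dvd (p := p)).2 (Int.natCast_dvd_natCast.2 hk)

theorem Zhat.exists_int_sub_dvd {m : ℕ} (hm : m ≠ 0) (y : Zhat) :
    ∃ c : ℤ, (m : Zhat) ∣ y - c := by
  induction m using Nat.recOnMul generalizing y with
  | zero => exact absurd rfl hm
  | one => exact ⟨0, by simp⟩
  | prime q hq =>
    obtain ⟨q, rfl⟩ : ∃ q' : Nat.Primes, q' = q := ⟨⟨q, hq⟩, rfl⟩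
    refine ⟨((y q).zmodRepr : ℤ), ?_⟩
    rw [pi_dvd_iff]
    intro p
    by_cases hpq : p = q
    · subst hpq
      have := PadicInt.sub_zmodRepr_mem (y p)
      rw [PadicInt.maximalIdeal_eq_span_p, Ideal.mem_span_singleton] at this
      simpa using this
    · refine IsUnit.dvd ?_
      rw [PadicInt.isUnit_iff, Pi.natCast_apply, PadicInt.norm_def, PadicInt.coe_natCast,
        Padic.norm_natCast_eq_one_iff, Nat.coprime_primes p.2 hq]
      exact fun h => hpq (Subtype.ext h)
  | mul a b ha hb =>
    obtain ⟨ha0, hb0⟩ := mul_ne_zero_iff.1 hm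
    obtain ⟨c, z, hz⟩ := ha ha0 y
    obtain ⟨c', w, hw⟩ := hb hb0 z
    refine ⟨c + a * c', w, ?_⟩
    push_cast
    linear_combination hz + a * hw

/-- The profinite integer `∑ k! bₖ` attached to a sequence `b` of integers. -/
noncomputable def Zhat.ofFactorialSeries : (ℕ → ℤ) →ₗ[ℤ] Zhat :=
  AddMonoidHom.toIntLinearMap
    { toFun := fun b p => ∑' k : ℕ, (k ! : ℤ_[(p : ℕ)]) * (b k : ℤ_[(p : ℕ)])
      map_zero' := by ext; simp
      map_add' := fun b c => by
        funext p
        simp only [Pi.add_apply, Int.cast_add, mul_add]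
        exact (PadicInt.summable_factorial_mul _).tsum_add (PadicInt.summable_factorial_mul _) }

theorem Zhat.ofFactorialSeries_apply (b : ℕ → ℤ) (p : Nat.Primes) :
    Zhat.ofFactorialSeries b p = ∑' k : ℕ, (k ! : ℤ_[(p : ℕ)]) * (b k : ℤ_[(p : ℕ)]) :=
  rfl

/-- Every profinite integer has a factorial expansion `∑ k! bₖ`. -/
theorem Zhat.ofFactorialSeries_surjective : Function.Surjective Zhat.ofFactorialSeries := by
  intro x
  choose c y hy using fun n : ℕ => Zhat.exists_int_sub_dvd n.succ_ne_zero
  let z : ℕ → Zhat := fun n => Nat.rec x (fun n z => y n z) n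
  let b : ℕ → ℤ := fun n => c n (z n)
  have hz (n : ℕ) : z n = b n + ((n + 1 : ℕ) : Zhat) * z (n + 1) := by
    linear_combination hy n (z n)
  have hx (n : ℕ) : x = ∑ k ∈ Finset.range n, (k ! : Zhat) * (b k : Zhat) + (n ! : Zhat) * z n := by
    induction n with
    | zero => simp [z]
    | succ n ih =>
      rw [Finset.sum_range_succ, Nat.factorial_succ]
      push_cast at hz ⊢
      linear_combination ih + (n ! : Zhat) * hz n
  refine ⟨b, funext fun p => PadicInt.tsum_factorial_mul_eq (z := fun n => z n p) fun n => ?_⟩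
  simpa using congrFun (hx n) p

theorem Zhat.ofFactorialSeries_eq_zero_iff (b : ℕ → ℤ) :
    Zhat.ofFactorialSeries b = 0 ↔
      ∃ a : ℕ → ℤ, b 0 = a 0 ∧ ∀ n : ℕ, b (n + 1) = (n + 2) * a (n + 1) - a n := by
  constructor
  · intro h
    have hdvd (n : ℕ) : (n ! : ℤ) ∣ ∑ k ∈ Finset.range n, (k ! : ℤ) * b k :=
      Int.natCast_dvd_of_forall_norm_le fun p => by
        have := PadicInt.norm_tsum_factorial_mul_sub_le (p := p) (fun k => (b k : ℤ_[(p : ℕ)])) n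
        rw [← Zhat.ofFactorialSeries_apply, h, Pi.zero_apply, zero_sub, norm_neg] at this
        exact_mod_cast this
    choose a ha using fun n => hdvd (n + 1)
    refine ⟨a, by simpa using ha 0, fun n => ?_⟩
    have h1 := ha (n + 1)
    rw [Finset.sum_range_succ, ha n, Nat.factorial_succ (n + 1)] at h1
    refine mul_left_cancel₀ (Nat.cast_ne_zero.2 (n + 1).factorial_ne_zero : ((n + 1)! : ℤ) ≠ 0) ?_
    push_cast at h1 ⊢
    linear_combination h1
  · rintro ⟨a, h0, h⟩
    have hs (n : ℕ) : ∑ k ∈ Finset.range (n + 1), (k ! : ℤ) * b k = ((n + 1)! : ℤ) * a n := by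
      induction n with
      | zero => simp [h0]
      | succ n ih =>
        rw [Finset.sum_range_succ, ih, h, Nat.factorial_succ (n + 1)]
        push_cast
        ring
    refine funext fun p => PadicInt.tsum_factorial_mul_eq
      (z := fun n => Nat.casesOn n 0 fun m => -(a m : ℤ_[(p : ℕ)])) fun n => ?_
    cases n with
    | zero => simp
    | succ n =>
      have := congrArg (Int.cast : ℤ → ℤ_[(p : ℕ)]) (hs n)
      push_cast at this
      simp [this]

theorem RatModInt.linearMap_int_eq_zero (f : RatModInt →ₗ[ℤ] ℤ) : f = 0 := by
  ext x
  obtain ⟨q, rfl⟩ := QuotientAddGroup.mk_surjective x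
  set N : ℤ := f (QuotientAddGroup.mk q) with hN
  refine Int.eq_zero_of_abs_lt_dvd (m := |N| + 1) ?_ (lt_add_one _)
  have hne : ((|N| + 1 : ℤ) : ℚ) ≠ 0 := by positivity
  refine ⟨f (QuotientAddGroup.mk (q / ((|N| + 1 : ℤ) : ℚ))), ?_⟩
  rw [← smul_eq_mul, ← map_smul, ← QuotientAddGroup.mk_zsmul, zsmul_eq_mul,
    mul_div_cancel₀ _ hne]

/-- The generators of the relations between the elements `1 / (n + 1)!` of `ℚ/ℤ`. -/
noncomputable def RatModInt.relation : ℕ → ℕ →₀ ℤ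
  | 0 => Finsupp.single 0 1
  | n + 1 => Finsupp.single (n + 1) (n + 2 : ℤ) - Finsupp.single n 1

/-- The map `ℤ^(ℕ) → ℤ^(ℕ)` presenting `ℚ/ℤ`. -/
noncomputable def RatModInt.presentation : (ℕ →₀ ℤ) →ₗ[ℤ] ℕ →₀ ℤ :=
  Finsupp.linearCombination ℤ RatModInt.relation

/-- The map `ℤ^(ℕ) → ℚ/ℤ` sending the basis vector of index `n` to the class of `1 / (n + 1)!`. -/
noncomputable def RatModInt.generators : (ℕ →₀ ℤ) →ₗ[ℤ] RatModInt :=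
  Finsupp.linearCombination ℤ fun n => (QuotientAddGroup.mk (1 / ((n + 1)! : ℚ)) : RatModInt)

namespace RatModInt

theorem presentation_apply (c : ℕ →₀ ℤ) (n : ℕ) :
    presentation c n = (n + 1) * c n - c (n + 1) := by
  induction c using Finsupp.induction_linear with
  | zero => simp
  | add f g hf hg => simp only [map_add, Finsupp.add_apply, hf, hg]; ring
  | single k m =>
    simp only [presentation, Finsupp.linearCombination_single]
    cases k with
    | zero =>
      rcases n with _ | n <;> simp [relation]
    | succ k =>
      simp only [relation, Finsupp.single_apply, Finsupp.smul_apply, Finsupp.sub_apply, smul_eq_mul,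
        add_left_inj]
      split_ifs <;> first | omega | (subst_vars; push_cast; ring)

theorem presentation_injective : Function.Injective presentation := by
  rw [injective_iff_map_eq_zero]
  intro c hc
  have hdown (n : ℕ) (h : c (n + 1) = 0) : c n = 0 := by
    have := presentation_apply c n
    rw [hc, h, Finsupp.zero_apply, sub_zero] at this
    exact (mul_eq_zero.1 this.symm).resolve_left (by positivity)
  have hlarge (n k : ℕ) (h : c (n + k) = 0) : c n = 0 := by
    induction k with
    | zero => exact h
    | succ k ih => exact ih (hdown _ h)
  ext n
  refine hlarge n (c.support.sup id + 1) (Finsupp.notMem_support_iff.1 fun h => ?_)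
  have := Finset.le_sup (f := id) h
  simp only [id] at this
  omega

theorem generators_single (n : ℕ) (m : ℤ) :
    generators (Finsupp.single n m) = QuotientAddGroup.mk (m / ((n + 1)! : ℚ)) := by
  rw [generators, Finsupp.linearCombination_single, ← QuotientAddGroup.mk_zsmul, zsmul_eq_mul,
    mul_one_div]

theorem mk_eq_zero_iff (q : ℚ) :
    (QuotientAddGroup.mk q : RatModInt) = 0 ↔ ∃ m : ℤ, (m : ℚ) = q := by
  rw [QuotientAddGroup.eq_zero_iff]
  rfl

theorem generators_surjective : Function.Surjective generators := by
  intro x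
  obtain ⟨q, rfl⟩ := QuotientAddGroup.mk_surjective x
  obtain ⟨k, hk⟩ : q.den ∣ (q.den + 1)! := Nat.dvd_factorial q.pos (Nat.le_succ _)
  refine ⟨Finsupp.single q.den (q.num * k), ?_⟩
  rw [generators_single, hk]
  congr 1
  have hk0 : (k : ℚ) ≠ 0 := by
    rintro h
    rw [Nat.cast_eq_zero.1 h, mul_zero] at hk
    exact Nat.factorial_ne_zero _ hk
  push_cast
  rw [mul_div_mul_right _ _ hk0, Rat.num_div_den]

theorem generators_comp_presentation : generators ∘ₗ presentation = 0 := by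
  ext k
  simp only [presentation, LinearMap.comp_apply, Finsupp.lsingle_apply,
    Finsupp.linearCombination_single, one_smul, LinearMap.zero_apply]
  cases k with
  | zero =>
    rw [relation, generators_single, mk_eq_zero_iff]
    exact ⟨1, by simp⟩
  | succ k =>
    rw [relation, map_sub, generators_single, generators_single, sub_eq_zero]
    congr 1
    rw [Nat.factorial_succ (k + 1)]
    push_cast
    have : ((k + 1)! : ℚ) ≠ 0 := by positivity
    field_simp
    ring

theorem single_sub_single_mem_range (n k : ℕ) :
    ∃ m : ℤ, Finsupp.single n 1 - Finsupp.single (n + k) m ∈ LinearMap.range presentation := by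
  induction k with
  | zero => exact ⟨1, by simp⟩
  | succ k ih =>
    obtain ⟨m, hm⟩ := ih
    refine ⟨m * (n + k + 2), ?_⟩
    have h : m • relation (n + k + 1) ∈ LinearMap.range presentation :=
      ⟨Finsupp.single (n + k + 1) m, Finsupp.linearCombination_single ..⟩
    convert sub_mem hm h using 1
    rw [relation, smul_sub, Finsupp.smul_single, Finsupp.smul_single, smul_eq_mul, smul_eq_mul,
      mul_one, Nat.cast_add, add_assoc n k 1]
    abel

theorem exists_sub_single_mem_range (x : ℕ →₀ ℤ) :
    ∃ N : ℕ, ∀ n ≥ N, ∃ m : ℤ, x - Finsupp.single n m ∈ LinearMap.range presentation := by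
  induction x using Finsupp.induction_linear with
  | zero => exact ⟨0, fun n _ => ⟨0, by simp⟩⟩
  | add f g hf hg =>
    obtain ⟨N, hN⟩ := hf
    obtain ⟨M, hM⟩ := hg
    refine ⟨max N M, fun n hn => ?_⟩
    obtain ⟨a, ha⟩ := hN n (le_of_max_le_left hn)
    obtain ⟨b, hb⟩ := hM n (le_of_max_le_right hn)
    refine ⟨a + b, ?_⟩
    rw [Finsupp.single_add, add_sub_add_comm]
    exact add_mem ha hb
  | single k c =>
    refine ⟨k, fun n hn => ?_⟩
    obtain ⟨j, rfl⟩ := Nat.exists_eq_add_of_le hn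
    obtain ⟨m, hm⟩ := single_sub_single_mem_range k j
    refine ⟨c * m, ?_⟩
    simpa [smul_sub] using (LinearMap.range presentation).smul_mem c hm

theorem single_factorial_mem_range (n : ℕ) :
    Finsupp.single n ((n + 1)! : ℤ) ∈ LinearMap.range presentation := by
  have hrel (n : ℕ) : relation n ∈ LinearMap.range presentation :=
    ⟨Finsupp.single n 1, by simp [presentation]⟩
  induction n with
  | zero => simpa [relation] using hrel 0
  | succ n ih =>
    convert add_mem ((LinearMap.range presentation).smul_mem ((n + 1)! : ℤ) (hrel (n + 1))) ih
      using 1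
    rw [relation, smul_sub, Finsupp.smul_single, Finsupp.smul_single, smul_eq_mul, smul_eq_mul,
      mul_one, sub_add_cancel, Nat.factorial_succ (n + 1)]
    congr 1
    push_cast
    ring

theorem ker_generators_le : LinearMap.ker generators ≤ LinearMap.range presentation := by
  intro x hx
  obtain ⟨N, hN⟩ := exists_sub_single_mem_range x
  obtain ⟨m, hm⟩ := hN N le_rfl
  have hπ (y) (hy : y ∈ LinearMap.range presentation) : generators y = 0 := by
    obtain ⟨z, rfl⟩ := hy
    exact LinearMap.congr_fun generators_comp_presentation z
  have h := hπ _ hm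
  rw [map_sub, LinearMap.mem_ker.1 hx, zero_sub, neg_eq_zero, generators_single,
    mk_eq_zero_iff] at h
  obtain ⟨a, ha⟩ := h
  have hma : m = a * ((N + 1)! : ℤ) := by
    rw [eq_div_iff (by positivity)] at ha
    exact_mod_cast ha.symm
  rw [← sub_add_cancel x (Finsupp.single N m)]
  refine add_mem hm ?_
  rw [hma]
  simpa using (LinearMap.range presentation).smul_mem a (single_factorial_mem_range N)

end RatModInt

theorem RatModInt.exists_comp_presentation_eq_iff (f : (ℕ →₀ ℤ) →ₗ[ℤ] ℤ) :
    Zhat.ofFactorialSeries (fun n => f (Finsupp.single n 1)) = 0 ↔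
      ∃ g : (ℕ →₀ ℤ) →ₗ[ℤ] ℤ, g ∘ₗ RatModInt.presentation = f := by
  rw [Zhat.ofFactorialSeries_eq_zero_iff]
  have hsingle (g : (ℕ →₀ ℤ) →ₗ[ℤ] ℤ) (n : ℕ) (m : ℤ) :
      g (Finsupp.single n m) = m * g (Finsupp.single n 1) := by
    rw [← smul_eq_mul, ← map_smul, Finsupp.smul_single_one]
  constructor
  · rintro ⟨a, h0, h⟩
    refine ⟨Finsupp.linearCombination ℤ a, ?_⟩
    ext n
    cases n <;>
      simp [RatModInt.presentation, RatModInt.relation, h0, h, add_mul]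
  · rintro ⟨g, rfl⟩
    refine ⟨fun n => g (Finsupp.single n 1), ?_, fun n => ?_⟩
    · simp [RatModInt.presentation, RatModInt.relation]
    · simp [RatModInt.presentation, RatModInt.relation, add_mul, hsingle g (n + 1) n,
        hsingle g (n + 1) 2]

/-- The free resolution `0 ⟶ ℤ^(ℕ) ⟶ ℤ^(ℕ) ⟶ ℚ/ℤ ⟶ 0`. -/
noncomputable def RatModInt.shortComplex : ShortComplex (ModuleCat.{0} ℤ) :=
  ShortComplex.mk (ModuleCat.ofHom RatModInt.presentation)
    (ModuleCat.ofHom RatModInt.generators) (by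
    rw [← ModuleCat.ofHom_comp, RatModInt.generators_comp_presentation]
    rfl)

theorem RatModInt.shortComplex_shortExact : RatModInt.shortComplex.ShortExact where
  exact := (ShortComplex.moduleCat_exact_iff_ker_sub_range _).2 RatModInt.ker_generators_le
  mono_f := (ModuleCat.mono_iff_injective _).2 RatModInt.presentation_injective
  epi_g := (ModuleCat.epi_iff_surjective _).2 RatModInt.generators_surjective

/-- `Hom_ℤ(ℚ/ℤ, ℤ) = 0` and `Ext¹_ℤ(ℚ/ℤ, ℤ) ≅ ∏_p ℤ_p`: the completion of `ℤ` at all the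
closed points of its spectrum is the product of the rings of `p`-adic integers. -/
theorem derived_completion_of_int_at_all_primes :
    (∀ f : RatModInt →ₗ[ℤ] ℤ, f = 0) ∧
    Nonempty ((((Ext ℤ (ModuleCat ℤ) 1).obj
        (Opposite.op (ModuleCat.of ℤ RatModInt))).obj (ModuleCat.of ℤ ℤ)) ≃+ Zhat) := by
  refine ⟨RatModInt.linearMap_int_eq_zero, ?_⟩
  have : Projective (ModuleCat.of ℤ (ℕ →₀ ℤ)) := inferInstance
  have : Projective RatModInt.shortComplex.X₁ := this
  have : Projective RatModInt.shortComplex.X₂ := this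
  let Φ : (RatModInt.shortComplex.X₁ ⟶ ModuleCat.of ℤ ℤ) →ₗ[ℤ] Zhat :=
    Zhat.ofFactorialSeries ∘ₗ
      { toFun := fun f n => f.hom (Finsupp.single n 1)
        map_add' := fun _ _ => rfl
        map_smul' := fun _ _ => rfl }
  obtain ⟨e⟩ := RatModInt.shortComplex_shortExact.nonempty_ext_one_iso Φ
    (fun x => by
      obtain ⟨b, rfl⟩ := Zhat.ofFactorialSeries_surjective x
      refine ⟨ModuleCat.ofHom (Finsupp.linearCombination ℤ b), ?_⟩
      exact congrArg Zhat.ofFactorialSeries (funext fun n =>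
        (Finsupp.linearCombination_single ℤ 1 n).trans (one_smul ℤ (b n))))
    (fun f => by
      refine (RatModInt.exists_comp_presentation_eq_iff f.hom).trans ⟨?_, ?_⟩
      · rintro ⟨g, hg⟩
        exact ⟨ModuleCat.ofHom g, ModuleCat.hom_ext hg⟩
      · rintro ⟨g, hg⟩
        exact ⟨g.hom, congrArg ModuleCat.Hom.hom hg⟩)
  exact ⟨e.toLinearEquiv.toAddEquiv⟩
end

section
/- Fix a prime number p and let I = (p) be the ideal of ℤ generated by p. The local cohomology of ℤ at I vanishes in degree 0 and is the Prüfer p-group in degree 1: the ℤ-module localCohomology I 0 applied to ℤ is zero, and the ℤ-module localCohomology I 1 applied to ℤ is isomorphic to ℤ[1/p]/ℤ, the quotient of the localization of ℤ away from p by the image of ℤ. (This computes Γ_(p) ℤ ≃ Σ^{-1}(ℤ[1/p]/ℤ).) -/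
open CategoryTheory

universe u

section LocalCohomology

open Opposite Limits

namespace HomologicalComplex

variable {C : Type*} [Category* C] [Abelian C] (K : ChainComplex C ℕ)

/-- If `K` vanishes in degree `2`, its homology in degree `1` embeds into `K.X 1`. -/
noncomputable def homologyOneι (hK : IsZero (K.X 2)) : K.homology 1 ⟶ K.X 1 :=
  (K.isoHomologyπ 2 1 (by simp) (hK.eq_of_src _ _)).inv ≫ K.iCycles 1

instance (hK : IsZero (K.X 2)) : Mono (homologyOneι K hK) := by
  unfold homologyOneι
  infer_instance

lemma homologyOneι_comp_d (hK : IsZero (K.X 2)) : homologyOneι K hK ≫ K.d 1 0 = 0 := by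
  simp [homologyOneι]

lemma homologyOneι_exact (hK : IsZero (K.X 2)) :
    (ShortComplex.mk _ _ (homologyOneι_comp_d K hK)).Exact := by
  have h := ShortComplex.exact_of_f_is_kernel
    (ShortComplex.mk (K.iCycles 1) (K.d 1 0) (K.iCycles_d 1 0)) (K.cyclesIsKernel 1 0 (by simp))
  have e : ShortComplex.mk _ _ (K.iCycles_d 1 0) ≅
      ShortComplex.mk _ _ (homologyOneι_comp_d K hK) :=
    ShortComplex.isoMk (K.isoHomologyπ 2 1 (by simp) (hK.eq_of_src _ _)) (Iso.refl _) (Iso.refl _)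
      (by simp [homologyOneι]) (by simp)
  exact ShortComplex.exact_of_iso e h

lemma homologyOneι_naturality {K L : ChainComplex C ℕ} (hK : IsZero (K.X 2))
    (hL : IsZero (L.X 2)) (φ : K ⟶ L) :
    homologyMap φ 1 ≫ homologyOneι L hL = homologyOneι K hK ≫ φ.f 1 := by
  rw [homologyOneι, homologyOneι, ← cancel_epi (K.homologyπ 1)]
  simp

end HomologicalComplex

section LeftDerivedOne

variable {C D : Type*} [Category* C] [Category* D] [Abelian C] [Abelian D]
  [HasProjectiveResolutions C] (F : C ⥤ D) [F.Additive] {X Y : C}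

namespace CategoryTheory.ProjectiveResolution

/-- Left derived functors as the homology of the image of a projective resolution. -/
noncomputable def leftDerivedObjIsoHomology (P : ProjectiveResolution X) (n : ℕ) :
    (F.leftDerived n).obj X ≅ ((F.mapHomologicalComplex (.down ℕ)).obj P.complex).homology n :=
  P.isoLeftDerivedObj F n

lemma leftDerivedObjIsoHomology_hom_naturality (P : ProjectiveResolution X)
    (Q : ProjectiveResolution Y) (f : X ⟶ Y) (φ : P.complex ⟶ Q.complex)
    (comm : φ.f 0 ≫ Q.π.f 0 = P.π.f 0 ≫ f) (n : ℕ) :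
    (F.leftDerived n).map f ≫ (Q.leftDerivedObjIsoHomology F n).hom =
      (P.leftDerivedObjIsoHomology F n).hom ≫
        HomologicalComplex.homologyMap ((F.mapHomologicalComplex (.down ℕ)).map φ) n :=
  isoLeftDerivedObj_hom_naturality f P Q φ comm F n

/-- For a projective resolution vanishing in degree `2`, the first left derived functor embeds
into the value of the functor on the degree `1` term. -/
noncomputable def leftDerivedOneι (P : ProjectiveResolution X)
    (hP : IsZero (((F.mapHomologicalComplex (.down ℕ)).obj P.complex).X 2)) :
    (F.leftDerived 1).obj X ⟶ ((F.mapHomologicalComplex (.down ℕ)).obj P.complex).X 1 :=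
  (P.leftDerivedObjIsoHomology F 1).hom ≫ HomologicalComplex.homologyOneι _ hP

instance (P : ProjectiveResolution X)
    (hP : IsZero (((F.mapHomologicalComplex (.down ℕ)).obj P.complex).X 2)) :
    Mono (P.leftDerivedOneι F hP) := by
  unfold leftDerivedOneι
  exact mono_comp _ _

lemma leftDerivedOneι_comp_d (P : ProjectiveResolution X)
    (hP : IsZero (((F.mapHomologicalComplex (.down ℕ)).obj P.complex).X 2)) :
    P.leftDerivedOneι F hP ≫ ((F.mapHomologicalComplex (.down ℕ)).obj P.complex).d 1 0 = 0 := by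
  rw [leftDerivedOneι, Category.assoc, HomologicalComplex.homologyOneι_comp_d, comp_zero]

lemma leftDerivedOneι_exact (P : ProjectiveResolution X)
    (hP : IsZero (((F.mapHomologicalComplex (.down ℕ)).obj P.complex).X 2)) :
    (ShortComplex.mk _ _ (P.leftDerivedOneι_comp_d F hP)).Exact := by
  have e : ShortComplex.mk _ _ (P.leftDerivedOneι_comp_d F hP) ≅
      ShortComplex.mk _ _ (HomologicalComplex.homologyOneι_comp_d _ hP) :=
    ShortComplex.isoMk (P.leftDerivedObjIsoHomology F 1) (Iso.refl _) (Iso.refl _)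
      (Category.comp_id _).symm ((Category.id_comp _).trans (Category.comp_id _).symm)
  exact ShortComplex.exact_of_iso e.symm (HomologicalComplex.homologyOneι_exact _ hP)

lemma leftDerivedOneι_naturality (P : ProjectiveResolution X)
    (hP : IsZero (((F.mapHomologicalComplex (.down ℕ)).obj P.complex).X 2))
    (Q : ProjectiveResolution Y)
    (hQ : IsZero (((F.mapHomologicalComplex (.down ℕ)).obj Q.complex).X 2)) (f : X ⟶ Y)
    (φ : P.complex ⟶ Q.complex) (comm : φ.f 0 ≫ Q.π.f 0 = P.π.f 0 ≫ f) :
    (F.leftDerived 1).map f ≫ Q.leftDerivedOneι F hQ =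
      P.leftDerivedOneι F hP ≫ ((F.mapHomologicalComplex (.down ℕ)).map φ).f 1 := by
  rw [leftDerivedOneι, ← Category.assoc, leftDerivedObjIsoHomology_hom_naturality F P Q f φ comm,
    leftDerivedOneι, Category.assoc, Category.assoc, ← HomologicalComplex.homologyOneι_naturality]

end CategoryTheory.ProjectiveResolution

end LeftDerivedOne

section Principal

variable {R : Type u} [CommRing R]

open nonZeroDivisors

/-- The Koszul complex `R ⟶ R` of an element `a`. -/
def principalComplex (a : R) : ChainComplex (ModuleCat.{u} R) ℕ where
  X
    | 0 => ModuleCat.of R R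
    | 1 => ModuleCat.of R R
    | _ + 2 => ModuleCat.of R PUnit
  d
    | 1, 0 => ModuleCat.ofHom (LinearMap.lsmul R R a)
    | _, _ => 0
  shape
    | 1, 0, h => (h rfl).elim
    | 0, _, _ => rfl
    | 1, _ + 1, _ => rfl
    | _ + 2, _, _ => rfl
  d_comp_d'
    | 0, _, _, h, _ => by simp at h
    | 1, _, _, _, h => by simp_all
    | _ + 2, _, _, _, _ => zero_comp

lemma isZero_principalComplex_X (a : R) (n : ℕ) : IsZero ((principalComplex a).X (n + 2)) :=
  ModuleCat.isZero_of_subsingleton (ModuleCat.of R PUnit)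

/-- The map of Koszul complexes given by multiplication by `c` in degree `1`. -/
def principalComplexMap (a b c : R) (h : b = a * c) :
    principalComplex b ⟶ principalComplex a where
  f
    | 0 => 𝟙 (ModuleCat.of R R)
    | 1 => ModuleCat.ofHom (LinearMap.lsmul R R c)
    | _ + 2 => 0
  comm'
    | 0, _, h => by simp at h
    | 1, 0, _ => by
      subst h
      ext
      change a * (c * 1) = (a * c) * 1
      ring
    | 1, _ + 1, h => by simp at h
    | n + 2, _, _ => (isZero_principalComplex_X b n).eq_of_src _ _

lemma principalComplex_d_comp_mkQ {J : Ideal R} {a : R} (hJ : J = Ideal.span {a}) :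
    ModuleCat.ofHom (LinearMap.lsmul R R a) ≫ ModuleCat.ofHom J.mkQ = 0 := by
  ext
  change Submodule.Quotient.mk (a * 1) = (0 : R ⧸ J)
  rw [Submodule.Quotient.mk_eq_zero, hJ, mul_one]
  exact Ideal.mem_span_singleton_self a

/-- The Koszul complex of a nonzerodivisor `a` resolves `R ⧸ (a)`. -/
noncomputable def principalResolution {J : Ideal R} {a : R} (ha : a ∈ R⁰)
    (hJ : J = Ideal.span {a}) : ProjectiveResolution (ModuleCat.of R (R ⧸ J)) where
  complex := principalComplex a
  projective
    | 0 => inferInstanceAs (Projective (ModuleCat.of R R))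
    | 1 => inferInstanceAs (Projective (ModuleCat.of R R))
    | n + 2 => (isZero_principalComplex_X a n).projective
  π := (ChainComplex.toSingle₀Equiv _ _).symm
    ⟨ModuleCat.ofHom J.mkQ, principalComplex_d_comp_mkQ hJ⟩
  quasiIso := ⟨fun n => by
    cases n with
    | zero =>
      rw [ChainComplex.quasiIsoAt₀_iff, ShortComplex.quasiIso_iff_of_zeros']
      · let S := ShortComplex.mk (X₁ := ModuleCat.of R R) (X₂ := ModuleCat.of R R)
          (X₃ := ModuleCat.of R (R ⧸ J)) (ModuleCat.ofHom (LinearMap.lsmul R R a))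
          (ModuleCat.ofHom J.mkQ) (principalComplex_d_comp_mkQ hJ)
        refine (ShortComplex.exact_and_epi_g_iff_of_iso (S₂ := S) ?_).2 ⟨?_, ?_⟩
        · exact ShortComplex.isoMk (Iso.refl _) (Iso.refl _) (Iso.refl _)
            ((Category.id_comp _).trans (Category.comp_id _).symm) (by
              refine (Category.id_comp _).trans (Eq.trans ?_ (Category.comp_id _).symm)
              exact (ChainComplex.toSingle₀Equiv_symm_apply_f_zero (C := principalComplex a)
                (X := ModuleCat.of R (R ⧸ J)) _ _).symm)
        · rw [ShortComplex.moduleCat_exact_iff]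
          intro x hx
          have hx' : x ∈ J := (Submodule.Quotient.mk_eq_zero _).1 hx
          rw [hJ, Ideal.mem_span_singleton] at hx'
          obtain ⟨y, rfl⟩ := hx'
          exact ⟨y, rfl⟩
        · exact (ModuleCat.epi_iff_surjective _).2 J.mkQ_surjective
      all_goals rfl
    | succ n =>
      rw [quasiIsoAt_iff_exactAt' _ _ (ChainComplex.exactAt_succ_single_obj _ _)]
      rw [HomologicalComplex.exactAt_iff' _ (n + 2) (n + 1) n (by simp) (by simp)]
      cases n with
      | zero =>
        rw [ShortComplex.moduleCat_exact_iff]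
        intro x hx
        exact ⟨0, ((mul_left_mem_nonZeroDivisors_eq_zero_iff ha).1 hx).symm⟩
      | succ n =>
        exact ShortComplex.exact_of_isZero_X₂ _ (isZero_principalComplex_X a n)⟩

end Principal

section ExtOne

variable {R : Type u} [CommRing R] {J K : Ideal R} {a b : R}

open nonZeroDivisors

/-- Elements of `M` as morphisms `R ⟶ M`. -/
noncomputable def ModuleCat.selfHomLinearEquiv (M : ModuleCat.{u} R) :
    M ≃ₗ[R] (ModuleCat.of R R ⟶ M) :=
  (LinearMap.ringLmapEquivSelf R R M).symm.trans
    (ModuleCat.homLinearEquiv (S := R) (M := ModuleCat.of R R) (N := M)).symm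

lemma ModuleCat.selfHomLinearEquiv_smul (M : ModuleCat.{u} R) (c : R) (m : M) :
    selfHomLinearEquiv M (c • m) =
      ofHom (LinearMap.lsmul R R c) ≫ selfHomLinearEquiv M m := by
  ext
  change (1 : R) • c • m = (c * 1 : R) • m
  simp

lemma isZero_linearYoneda_principalResolution (ha : a ∈ R⁰) (hJ : J = Ideal.span {a})
    (M : ModuleCat.{u} R) :
    IsZero (((((linearYoneda R (ModuleCat.{u} R)).obj M).rightOp.mapHomologicalComplex
      (.down ℕ)).obj (principalResolution ha hJ).complex).X 2) :=
  Functor.map_isZero ((linearYoneda R (ModuleCat.{u} R)).obj M).rightOp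
    (isZero_principalComplex_X a 0)

/-- The surjection `M → Ext¹(R ⧸ J, M)` where `J` is generated by a nonzerodivisor. -/
noncomputable def extOneMk (ha : a ∈ R⁰) (hJ : J = Ideal.span {a}) (M : ModuleCat.{u} R) :
    M →ₗ[R] ((Ext R (ModuleCat.{u} R) 1).obj (op (ModuleCat.of R (R ⧸ J)))).obj M :=
  ((principalResolution ha hJ).leftDerivedOneι ((linearYoneda R (ModuleCat.{u} R)).obj M).rightOp
    (isZero_linearYoneda_principalResolution ha hJ M)).unop.hom ∘ₗ
      (ModuleCat.selfHomLinearEquiv M).toLinearMap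

lemma extOneMk_surjective (ha : a ∈ R⁰) (hJ : J = Ideal.span {a}) (M : ModuleCat.{u} R) :
    Function.Surjective (extOneMk ha hJ M) := by
  have h := (ModuleCat.epi_iff_surjective _).1 (unop_epi_of_mono
    ((principalResolution ha hJ).leftDerivedOneι
      ((linearYoneda R (ModuleCat.{u} R)).obj M).rightOp
      (isZero_linearYoneda_principalResolution ha hJ M)))
  exact h.comp (ModuleCat.selfHomLinearEquiv M).surjective

lemma extOneMk_eq_zero_iff (ha : a ∈ R⁰) (hJ : J = Ideal.span {a}) (M : ModuleCat.{u} R)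
    (m : M) : extOneMk ha hJ M m = 0 ↔ ∃ n : M, a • n = m := by
  have h := ((principalResolution ha hJ).leftDerivedOneι_exact
      ((linearYoneda R (ModuleCat.{u} R)).obj M).rightOp
      (isZero_linearYoneda_principalResolution ha hJ M)).unop
  rw [ShortComplex.ShortExact.moduleCat_exact_iff_function_exact] at h
  refine (h (ModuleCat.selfHomLinearEquiv M m)).trans ⟨?_, ?_⟩
  · rintro ⟨g, hg⟩
    obtain ⟨n, rfl⟩ := (ModuleCat.selfHomLinearEquiv M).surjective g
    refine ⟨n, (ModuleCat.selfHomLinearEquiv M).injective ?_⟩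
    rw [ModuleCat.selfHomLinearEquiv_smul]
    exact hg
  · rintro ⟨n, rfl⟩
    exact ⟨ModuleCat.selfHomLinearEquiv M n, (ModuleCat.selfHomLinearEquiv_smul M a n).symm⟩

lemma ext_map_extOneMk (ha : a ∈ R⁰) (hJ : J = Ideal.span {a}) (hb : b ∈ R⁰)
    (hK : K = Ideal.span {b}) (hKJ : K ≤ J) (c : R) (hc : b = a * c) (M : ModuleCat.{u} R)
    (m : M) :
    (((Ext R (ModuleCat.{u} R) 1).map
      (ModuleCat.ofHom (Submodule.mapQ K J LinearMap.id hKJ)).op).app M).hom (extOneMk ha hJ M m) =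
      extOneMk hb hK M (c • m) := by
  have h := congrArg Quiver.Hom.unop
    ((principalResolution hb hK).leftDerivedOneι_naturality
      ((linearYoneda R (ModuleCat.{u} R)).obj M).rightOp
      (isZero_linearYoneda_principalResolution hb hK M) (principalResolution ha hJ)
      (isZero_linearYoneda_principalResolution ha hJ M)
      (ModuleCat.ofHom (Submodule.mapQ K J LinearMap.id hKJ)) (principalComplexMap a b c hc)
      (by
        simp only [principalResolution]
        rfl))
  refine (congrArg (fun g ↦ g.hom (ModuleCat.selfHomLinearEquiv M m)) h).trans ?_
  exact (congrArg ((principalResolution hb hK).leftDerivedOneι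
    ((linearYoneda R (ModuleCat.{u} R)).obj M).rightOp
    (isZero_linearYoneda_principalResolution hb hK M)).unop.hom
      (ModuleCat.selfHomLinearEquiv_smul M c m)).symm

lemma isZero_ext_zero_of_nonZeroDivisor (ha : a ∈ R⁰) (hJ : J = Ideal.span {a})
    (M : ModuleCat.{u} R) (hM : ∀ m : M, a • m = 0 → m = 0) :
    IsZero (((Ext R (ModuleCat.{u} R) 0).obj (op (ModuleCat.of R (R ⧸ J)))).obj M) := by
  refine IsZero.of_iso ?_ ((principalResolution ha hJ).isoExt 0 M)
  rw [← HomologicalComplex.exactAt_iff_isZero_homology,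
    HomologicalComplex.exactAt_iff' _ 0 0 1 (by simp) (by simp),
    ShortComplex.moduleCat_exact_iff]
  intro g hg
  refine ⟨0, ?_⟩
  rw [map_zero]
  obtain ⟨m, rfl⟩ := (ModuleCat.selfHomLinearEquiv M).surjective g
  have h : ModuleCat.selfHomLinearEquiv M (a • m) = 0 :=
    (ModuleCat.selfHomLinearEquiv_smul M a m).trans hg
  rw [hM m ((ModuleCat.selfHomLinearEquiv M).map_eq_zero_iff.1 h)]
  exact (map_zero _).symm

end ExtOne

namespace localCohomology

variable {R : Type u} [CommRing R] {a : R}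

open nonZeroDivisors

/-- Local cohomology of a module as the colimit of a diagram of `Ext` modules. -/
noncomputable def isColimitEvaluation (I : Ideal R) (i : ℕ) (M : ModuleCat.{u} R) :
    IsColimit (((evaluation (ModuleCat.{u} R) (ModuleCat.{u} R)).obj M).mapCocone
      (colimit.cocone (diagram (idealPowersDiagram I) i))) :=
  isColimitOfPreserves _ (colimit.isColimit _)

lemma isZero_zero_of_nonZeroDivisor (ha : a ∈ R⁰) (M : ModuleCat.{u} R)
    (hM : ∀ m : M, a • m = 0 → m = 0) :
    IsZero ((localCohomology (Ideal.span {a}) 0).obj M) := by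
  have hM' (n : ℕ) (m : M) (h : a ^ n • m = 0) : m = 0 := by
    induction n with
    | zero => simpa using h
    | succ n ih => exact ih (hM _ (by rwa [smul_smul, ← pow_succ']))
  rw [IsZero.iff_id_eq_zero]
  refine (isColimitEvaluation (Ideal.span {a}) 0 M).hom_ext fun n ↦ ?_
  exact (isZero_ext_zero_of_nonZeroDivisor (pow_mem ha _) (Ideal.span_singleton_pow a _) M
    (hM' n.unop.unop)).eq_of_src _ _

/-- Let `a` be a nonzerodivisor. A family of maps `ψ n : M → N`, with `ψ n` thought of as
`m ↦ m / a ^ n`, identifies the first local cohomology of `M` at `(a)` with `N`. -/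
theorem nonempty_linearEquiv_one (ha : a ∈ R⁰) (M N : ModuleCat.{u} R) (ψ : ℕ → M →ₗ[R] N)
    (hψ : ∀ n m, ψ (n + 1) (a • m) = ψ n m) (hker : ∀ n m, ψ n m = 0 ↔ ∃ x : M, a ^ n • x = m)
    (hsurj : ∀ y, ∃ n m, ψ n m = y) :
    Nonempty ((localCohomology (Ideal.span {a}) 1).obj M ≃ₗ[R] N) := by
  have hψ' (n k : ℕ) (m : M) : ψ (n + k) (a ^ k • m) = ψ n m := by
    induction k with
    | zero => simp
    | succ k ih => rw [← add_assoc, pow_succ', mul_smul, hψ, ih]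
  let q (n : ℕ) := extOneMk (pow_mem ha n) (Ideal.span_singleton_pow a n) M
  have hq (n : ℕ) : Function.Surjective (q n) := extOneMk_surjective _ _ _
  have hle (n : ℕ) : LinearMap.ker (q n) ≤ LinearMap.ker (ψ n) := fun m hm ↦
    (hker n m).2 ((extOneMk_eq_zero_iff _ _ _ _).1 hm)
  let φ (n : ℕ) := (LinearMap.ker (q n)).liftQ (ψ n) (hle n) ∘ₗ
    ((q n).quotKerEquivOfSurjective (hq n)).symm.toLinearMap
  have hφ (n : ℕ) (m : M) : φ n (q n m) = ψ n m :=
    congrArg ((LinearMap.ker (q n)).liftQ (ψ n) (hle n)) (a₁ := ((q n).quotKerEquivOfSurjective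
      (hq n)).symm (q n m)) (a₂ := Submodule.Quotient.mk m) ((LinearEquiv.symm_apply_eq _).2 rfl)
  let c : Cocone (diagram (idealPowersDiagram (Ideal.span {a})) 1 ⋙
      (evaluation (ModuleCat.{u} R) (ModuleCat.{u} R)).obj M) :=
    { pt := N
      ι :=
        { app n := ModuleCat.ofHom (φ n.unop.unop)
          naturality := fun i j f ↦ by
            ext y
            obtain ⟨m, rfl⟩ := hq _ y
            obtain ⟨k, hk⟩ := Nat.exists_eq_add_of_le (leOfHom f.unop.unop)
            have hpow : a ^ j.unop.unop = a ^ i.unop.unop * a ^ k := by rw [hk, pow_add]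
            refine (congrArg (φ j.unop.unop) (ext_map_extOneMk _ _ (pow_mem ha j.unop.unop)
              (Ideal.span_singleton_pow a j.unop.unop)
              (Ideal.pow_le_pow_right (leOfHom f.unop.unop)) (a ^ k) hpow M m)).trans ?_
            refine (hφ _ _).trans (Eq.trans ?_ (hφ _ _).symm)
            rw [hk, hψ'] } }
  let hc := isColimitEvaluation (Ideal.span {a}) 1 M
  have hdesc (n : ℕ) (m : M) : (hc.desc c).hom ((((evaluation (ModuleCat.{u} R)
      (ModuleCat.{u} R)).obj M).mapCocone (colimit.cocone (diagram (idealPowersDiagram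
        (Ideal.span {a})) 1))).ι.app (op (op n)) (q n m)) = ψ n m :=
    (congrArg (fun g ↦ g.hom (q n m)) (hc.fac c (op (op n)))).trans (hφ n m)
  refine ⟨LinearEquiv.ofBijective (hc.desc c).hom ⟨?_, fun y ↦ ?_⟩⟩
  · have := preservesSmallestFilteredColimits_of_preservesFilteredColimits
      (forget (ModuleCat.{u} R))
    rw [injective_iff_map_eq_zero]
    intro x hx
    obtain ⟨n, y, rfl⟩ := Concrete.isColimit_exists_rep _ hc x
    obtain ⟨m, rfl⟩ := hq n.unop.unop y
    have hm := (hker _ _).1 ((hdesc _ _).symm.trans hx)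
    rw [show q _ m = 0 from (extOneMk_eq_zero_iff _ _ _ _).2 hm]
    exact map_zero _
  · obtain ⟨n, m, rfl⟩ := hsurj y
    exact ⟨_, hdesc n m⟩

end localCohomology

end LocalCohomology

namespace PruferQuot

variable (p : ℕ)

/-- The map sending `m` to the class of `m / p ^ n`. -/
noncomputable def divPow (n : ℕ) : ℤ →ₗ[ℤ] PruferQuot p :=
  LinearMap.toSpanSingleton ℤ (PruferQuot p)
    (QuotientAddGroup.mk (IsLocalization.Away.invSelf (p : ℤ) ^ n))

lemma divPow_apply (n : ℕ) (m : ℤ) : divPow p n m =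
    QuotientAddGroup.mk ((m : Localization.Away (p : ℤ)) *
      IsLocalization.Away.invSelf (p : ℤ) ^ n) := by
  rw [← zsmul_eq_mul]
  rfl

lemma cast_mul_invSelf : ((p : ℤ) : Localization.Away (p : ℤ)) *
    IsLocalization.Away.invSelf (p : ℤ) = 1 :=
  (congrArg (· * _) (eq_intCast (algebraMap ℤ (Localization.Away (p : ℤ))) p).symm).trans
    (IsLocalization.Away.mul_invSelf (p : ℤ))

lemma cast_pow_mul_invSelf_pow (n : ℕ) : (((p : ℤ) ^ n : ℤ) : Localization.Away (p : ℤ)) *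
    IsLocalization.Away.invSelf (p : ℤ) ^ n = 1 := by
  rw [Int.cast_pow, ← mul_pow, cast_mul_invSelf, one_pow]

lemma divPow_succ (n : ℕ) (m : ℤ) : divPow p (n + 1) ((p : ℤ) • m) = divPow p n m := by
  rw [divPow_apply, divPow_apply, smul_eq_mul, Int.cast_mul, pow_succ']
  congr 1
  linear_combination (m : Localization.Away (p : ℤ)) *
    IsLocalization.Away.invSelf (p : ℤ) ^ n * cast_mul_invSelf p

lemma divPow_eq_zero_iff {p : ℕ} (hp : p ≠ 0) (n : ℕ) (m : ℤ) :
    divPow p n m = 0 ↔ ∃ x : ℤ, (p : ℤ) ^ n • x = m := by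
  have hinj : Function.Injective (algebraMap ℤ (Localization.Away (p : ℤ))) :=
    IsLocalization.injective _
      (powers_le_nonZeroDivisors_of_noZeroDivisors (Int.natCast_ne_zero.2 hp))
  rw [divPow_apply, QuotientAddGroup.eq_zero_iff]
  constructor
  · rintro ⟨x, hx⟩
    replace hx : (x : Localization.Away (p : ℤ)) = m * _ := hx
    refine ⟨x, hinj ?_⟩
    rw [eq_intCast, eq_intCast, smul_eq_mul, Int.cast_mul, hx]
    linear_combination (m : Localization.Away (p : ℤ)) * cast_pow_mul_invSelf_pow p n
  · rintro ⟨x, rfl⟩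
    refine ⟨x, ?_⟩
    change (x : Localization.Away (p : ℤ)) = _
    rw [smul_eq_mul, Int.cast_mul]
    linear_combination -(x : Localization.Away (p : ℤ)) * cast_pow_mul_invSelf_pow p n

lemma exists_divPow_eq (y : PruferQuot p) : ∃ n m, divPow p n m = y := by
  obtain ⟨z, rfl⟩ := QuotientAddGroup.mk_surjective y
  obtain ⟨n, m, h⟩ := IsLocalization.Away.surj (p : ℤ) z
  refine ⟨n, m, ?_⟩
  rw [divPow_apply]
  congr 1
  rw [eq_intCast, eq_intCast] at h
  have h' := cast_pow_mul_invSelf_pow p n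
  rw [Int.cast_pow] at h'
  linear_combination -IsLocalization.Away.invSelf (p : ℤ) ^ n * h + z * h'

end PruferQuot

/-- The local cohomology of `ℤ` at the ideal `(p)` vanishes in degree `0` and is the
Prüfer `p`-group `ℤ[1/p]/ℤ` in degree `1`. -/
theorem local_cohomology_of_int_at_p (p : ℕ) [Fact p.Prime] :
    Limits.IsZero ((localCohomology (Ideal.span {(p : ℤ)}) 0).obj (ModuleCat.of ℤ ℤ)) ∧
    Nonempty
      ((((localCohomology (Ideal.span {(p : ℤ)}) 1).obj (ModuleCat.of ℤ ℤ)) ≃ₗ[ℤ]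
        PruferQuot p)) := by
  have hp : p ≠ 0 := (Fact.out : p.Prime).ne_zero
  have ha : (p : ℤ) ∈ nonZeroDivisors ℤ :=
    mem_nonZeroDivisors_of_ne_zero (Int.natCast_ne_zero.2 hp)
  exact ⟨localCohomology.isZero_zero_of_nonZeroDivisor ha _ fun m hm ↦
      (mul_left_mem_nonZeroDivisors_eq_zero_iff ha).1 hm,
    localCohomology.nonempty_linearEquiv_one ha (ModuleCat.of ℤ ℤ) (ModuleCat.of ℤ (PruferQuot p))
      (PruferQuot.divPow p) (PruferQuot.divPow_succ p) (PruferQuot.divPow_eq_zero_iff hp)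
      (PruferQuot.exists_divPow_eq p)⟩
end
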